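/- arXiv:2109.14461 — 5 statements merged into one kernel-verified Lean document; each statement's English description precedes it below -/
import Mathlib

section
/- Positive semidefiniteness of the adversary's Riccati recursion: define symmetric matrices P̂_t backward by P̂_T := Q_T and, for t = T−1,…,0, P̂_t := Q_t + Aᵀ P̂_{t+1} A + Aᵀ P̂_{t+1} C (S_t − Cᵀ P̂_{t+1} C)⁻¹ Cᵀ P̂_{t+1} A, under the standing assumption that S_t − Cᵀ P̂_{t+1} C is positive definite for every t = 0,…,T−1 (so that the inverse exists). Then for every t = 0,…,T the matrix P̂_t is symmetric positive semidefinite. -/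
open Matrix

noncomputable section

/-- positive semidefiniteness of the adversary's Riccati recursion
`P̂_T = Q_T`, `P̂_t = Q_t + Aᵀ P̂_{t+1} A + Aᵀ P̂_{t+1} C (S_t - Cᵀ P̂_{t+1} C)⁻¹ Cᵀ P̂_{t+1} A`,
under the standing assumption `S_t - Cᵀ P̂_{t+1} C > 0`. -/
theorem adversary_riccati_posSemidef
    {z v : ℕ} (hz : 1 ≤ z) (hv : 1 ≤ v) (T : ℕ) (hT : 1 ≤ T)
    (A : Matrix (Fin z) (Fin z) ℝ) (C : Matrix (Fin z) (Fin v) ℝ)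
    (Q : ℕ → Matrix (Fin z) (Fin z) ℝ) (hQ : ∀ t ≤ T, (Q t).PosSemidef)
    (S : ℕ → Matrix (Fin v) (Fin v) ℝ) (hS : ∀ t < T, (S t).PosDef)
    (Phat : ℕ → Matrix (Fin z) (Fin z) ℝ)
    (hPT : Phat T = Q T)
    (hcond : ∀ t < T, (S t - Cᵀ * Phat (t + 1) * C).PosDef)
    (hPrec : ∀ t < T, Phat t = Q t + Aᵀ * Phat (t + 1) * A
      + Aᵀ * Phat (t + 1) * C * (S t - Cᵀ * Phat (t + 1) * C)⁻¹ * Cᵀ * Phat (t + 1) * A) :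
    ∀ t ≤ T, (Phat t).PosSemidef := by
  have key : ∀ t ≤ T, (Phat (T - t)).PosSemidef := by
    intro t
    induction t with
    | zero =>
      intro _
      rw [Nat.sub_zero, hPT]
      exact hQ T le_rfl
    | succ n ih =>
      intro hn
      have hP := ih (by omega)
      obtain ⟨k, hk⟩ : ∃ k, k = T - (n + 1) := ⟨_, rfl⟩
      have hk1 : T - n = k + 1 := by omega
      have hkT : k < T := by omega
      rw [hk1] at hP
      rw [← hk, hPrec k hkT]
      have h1 := hP.conjTranspose_mul_mul_same A
      have h2 := (hcond k hkT).inv.posSemidef.conjTranspose_mul_mul_same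
        (Cᵀ * Phat (k + 1) * A)
      have hsym : (Phat (k + 1))ᵀ = Phat (k + 1) := by
        simpa [Matrix.IsHermitian] using hP.isHermitian
      have h3 := ((hQ k hkT.le).add h1).add h2
      simpa only [conjTranspose_eq_transpose_of_trivial, transpose_mul, transpose_transpose,
        hsym, Matrix.mul_assoc] using h3
  intro t ht
  have h := key (T - t) (by omega)
  rwa [Nat.sub_sub_self ht] at h

end
end

section
/- Linear co-state representation for the global mean-field forward–backward system: suppose the sequences (Z̄_t)_{t=0,…,T} and (ζ̄_t)_{t=0,…,T} in R^z satisfy the forward equation Z̄_{t+1} = A Z̄_t − D_t ζ̄_{t+1} for t = 0,…,T−1 and the backward equation ζ̄_t = Aᵀ ζ̄_{t+1} + Q_t Z̄_t for t = 0,…,T−1 with terminal condition ζ̄_T = Q_T Z̄_T. Then ζ̄_t = P̄_t Z̄_t for every t = 0,…,T, and consequently Z̄_{t+1} = F̄_t Z̄_t for every t = 0,…,T−1. -/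
open Matrix

noncomputable section

/-- linear co-state representation for the global mean-field
forward–backward system: `ζ̄_t = P̄_t Z̄_t` and `Z̄_{t+1} = F̄_t Z̄_t`. -/
theorem global_mf_linear_costate
    {z u v : ℕ} (hz : 1 ≤ z) (hu : 1 ≤ u) (hv : 1 ≤ v) (T : ℕ) (hT : 1 ≤ T)
    (A : Matrix (Fin z) (Fin z) ℝ) (B : Matrix (Fin z) (Fin u) ℝ) (C : Matrix (Fin z) (Fin v) ℝ)
    (Q : ℕ → Matrix (Fin z) (Fin z) ℝ) (hQ : ∀ t ≤ T, (Q t).PosSemidef)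
    (R : ℕ → Matrix (Fin u) (Fin u) ℝ) (hR : ∀ t < T, (R t).PosDef)
    (S : ℕ → Matrix (Fin v) (Fin v) ℝ) (hS : ∀ t < T, (S t).PosDef)
    (D : ℕ → Matrix (Fin z) (Fin z) ℝ)
    (hD : ∀ t < T, D t = B * (R t)⁻¹ * Bᵀ - C * (S t)⁻¹ * Cᵀ)
    (Pbar E Fbar : ℕ → Matrix (Fin z) (Fin z) ℝ)
    (hPT : Pbar T = Q T)
    (hE : ∀ t < T, E t = 1 + D t * Pbar (t + 1))
    (hEinv : ∀ t < T, IsUnit (E t))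
    (hPrec : ∀ t < T, Pbar t = Aᵀ * Pbar (t + 1) * (E t)⁻¹ * A + Q t)
    (hF : ∀ t < T, Fbar t = (E t)⁻¹ * A)
    (Zbar ζbar : ℕ → Fin z → ℝ)
    (hfwd : ∀ t < T, Zbar (t + 1) = A *ᵥ Zbar t - D t *ᵥ ζbar (t + 1))
    (hbwd : ∀ t < T, ζbar t = Aᵀ *ᵥ ζbar (t + 1) + Q t *ᵥ Zbar t)
    (hterm : ζbar T = Q T *ᵥ Zbar T) :
    (∀ t ≤ T, ζbar t = Pbar t *ᵥ Zbar t) ∧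
    (∀ t < T, Zbar (t + 1) = Fbar t *ᵥ Zbar t) := by
  have step : ∀ t < T, ζbar (t + 1) = Pbar (t + 1) *ᵥ Zbar (t + 1) →
      Zbar (t + 1) = Fbar t *ᵥ Zbar t := by
    intro t ht h
    have h1 : E t *ᵥ Zbar (t + 1) = A *ᵥ Zbar t := by
      have h2 := hfwd t ht
      rw [h, mulVec_mulVec] at h2
      rw [hE t ht, add_mulVec, one_mulVec]
      exact eq_sub_iff_add_eq.mp h2
    rw [hF t ht, ← mulVec_mulVec, ← h1, mulVec_mulVec,
      nonsing_inv_mul _ ((isUnit_iff_isUnit_det _).mp (hEinv t ht)), one_mulVec]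
  have main : ∀ t ≤ T, ζbar t = Pbar t *ᵥ Zbar t := by
    intro t ht
    induction ht using Nat.decreasingInduction with
    | self => rw [hterm, hPT]
    | of_succ t ht ih =>
      rw [hbwd t ht, ih, step t ht ih, hPrec t ht, hF t ht, add_mulVec]
      simp only [mulVec_mulVec, Matrix.mul_assoc]
  exact ⟨main, fun t ht => step t ht (main (t + 1) ht)⟩

end
end

section
/- Existence, uniqueness and linear dynamics of the equilibrium global mean field: for every x₀ ∈ R^z there exists exactly one pair of sequences (Z̄_t)_{t=0,…,T}, (ζ̄_t)_{t=0,…,T} in R^z with Z̄_0 = x₀ satisfying the coupled system Z̄_{t+1} = A Z̄_t − D_t ζ̄_{t+1} (t = 0,…,T−1), ζ̄_t = Aᵀ ζ̄_{t+1} + Q_t Z̄_t (t = 0,…,T−1), ζ̄_T = Q_T Z̄_T; this unique solution is given explicitly by the linear dynamics Z̄_{t+1} = F̄_t Z̄_t together with ζ̄_t = P̄_t Z̄_t. -/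
open Matrix

noncomputable section

/-- existence, uniqueness and linear dynamics of the equilibrium
global mean field: for every initial condition there is exactly one solution
`(Z̄, ζ̄)` (on indices `0,…,T`) of the coupled forward–backward system, and it is
given by `Z̄_{t+1} = F̄_t Z̄_t`, `ζ̄_t = P̄_t Z̄_t`. -/
theorem global_mf_exists_unique
    {z u v : ℕ} (hz : 1 ≤ z) (hu : 1 ≤ u) (hv : 1 ≤ v) (T : ℕ) (hT : 1 ≤ T)
    (A : Matrix (Fin z) (Fin z) ℝ) (B : Matrix (Fin z) (Fin u) ℝ) (C : Matrix (Fin z) (Fin v) ℝ)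
    (Q : ℕ → Matrix (Fin z) (Fin z) ℝ) (hQ : ∀ t ≤ T, (Q t).PosSemidef)
    (R : ℕ → Matrix (Fin u) (Fin u) ℝ) (hR : ∀ t < T, (R t).PosDef)
    (S : ℕ → Matrix (Fin v) (Fin v) ℝ) (hS : ∀ t < T, (S t).PosDef)
    (D : ℕ → Matrix (Fin z) (Fin z) ℝ)
    (hD : ∀ t < T, D t = B * (R t)⁻¹ * Bᵀ - C * (S t)⁻¹ * Cᵀ)
    (Pbar E Fbar : ℕ → Matrix (Fin z) (Fin z) ℝ)
    (hPT : Pbar T = Q T)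
    (hE : ∀ t < T, E t = 1 + D t * Pbar (t + 1))
    (hEinv : ∀ t < T, IsUnit (E t))
    (hPrec : ∀ t < T, Pbar t = Aᵀ * Pbar (t + 1) * (E t)⁻¹ * A + Q t)
    (hF : ∀ t < T, Fbar t = (E t)⁻¹ * A)
    (x₀ : Fin z → ℝ) :
    (∃ Zbar ζbar : ℕ → Fin z → ℝ,
      Zbar 0 = x₀ ∧
      (∀ t < T, Zbar (t + 1) = A *ᵥ Zbar t - D t *ᵥ ζbar (t + 1)) ∧
      (∀ t < T, ζbar t = Aᵀ *ᵥ ζbar (t + 1) + Q t *ᵥ Zbar t) ∧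
      ζbar T = Q T *ᵥ Zbar T ∧
      (∀ t < T, Zbar (t + 1) = Fbar t *ᵥ Zbar t) ∧
      (∀ t ≤ T, ζbar t = Pbar t *ᵥ Zbar t)) ∧
    (∀ Zbar ζbar Zbar' ζbar' : ℕ → Fin z → ℝ,
      Zbar 0 = x₀ →
      (∀ t < T, Zbar (t + 1) = A *ᵥ Zbar t - D t *ᵥ ζbar (t + 1)) →
      (∀ t < T, ζbar t = Aᵀ *ᵥ ζbar (t + 1) + Q t *ᵥ Zbar t) →
      ζbar T = Q T *ᵥ Zbar T →
      Zbar' 0 = x₀ →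
      (∀ t < T, Zbar' (t + 1) = A *ᵥ Zbar' t - D t *ᵥ ζbar' (t + 1)) →
      (∀ t < T, ζbar' t = Aᵀ *ᵥ ζbar' (t + 1) + Q t *ᵥ Zbar' t) →
      ζbar' T = Q T *ᵥ Zbar' T →
      ∀ t ≤ T, Zbar t = Zbar' t ∧ ζbar t = ζbar' t) := by
  have hmul : ∀ t < T, E t * (E t)⁻¹ = 1 := fun t ht =>
    Matrix.mul_nonsing_inv _ ((Matrix.isUnit_iff_isUnit_det _).1 (hEinv t ht))
  have hmul' : ∀ t < T, (E t)⁻¹ * E t = 1 := fun t ht =>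
    Matrix.nonsing_inv_mul _ ((Matrix.isUnit_iff_isUnit_det _).1 (hEinv t ht))
  -- one step of the forward dynamics, given the feedback form at the next time
  have step : ∀ t < T, ∀ x y w : Fin z → ℝ, y = A *ᵥ x - D t *ᵥ w → w = Pbar (t + 1) *ᵥ y →
      y = Fbar t *ᵥ x := by
    intro t ht x y w h1 h2
    have h3 : E t *ᵥ y = A *ᵥ x := by
      rw [hE t ht, Matrix.add_mulVec, Matrix.one_mulVec, ← Matrix.mulVec_mulVec, ← h2]
      nth_rewrite 1 [h1]
      abel
    rw [hF t ht, ← Matrix.mulVec_mulVec, ← h3, Matrix.mulVec_mulVec, hmul' t ht,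
      Matrix.one_mulVec]
  have adj : ∀ t < T, ∀ x : Fin z → ℝ,
      Pbar t *ᵥ x = Aᵀ *ᵥ (Pbar (t + 1) *ᵥ (Fbar t *ᵥ x)) + Q t *ᵥ x := by
    intro t ht x
    rw [hPrec t ht, hF t ht, Matrix.add_mulVec]
    simp only [Matrix.mulVec_mulVec, Matrix.mul_assoc]
  have key : ∀ Z ζ : ℕ → Fin z → ℝ,
      (∀ t < T, Z (t + 1) = A *ᵥ Z t - D t *ᵥ ζ (t + 1)) →
      (∀ t < T, ζ t = Aᵀ *ᵥ ζ (t + 1) + Q t *ᵥ Z t) →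
      ζ T = Q T *ᵥ Z T → ∀ t ≤ T, ζ t = Pbar t *ᵥ Z t := by
    intro Z ζ h1 h2 h3
    have aux : ∀ k t : ℕ, t + k = T → ζ t = Pbar t *ᵥ Z t := by
      intro k
      induction k with
      | zero =>
        intro t ht
        obtain rfl : t = T := by omega
        rw [hPT, h3]
      | succ k ih =>
        intro t ht
        have htT : t < T := by omega
        have h4 := ih (t + 1) (by omega)
        have h5 := step t htT _ _ _ (h1 t htT) h4
        rw [h2 t htT, adj t htT, ← h5, ← h4]
    intro t ht
    exact aux (T - t) t (by omega)
  refine ⟨?_, ?_⟩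
  · let Z : ℕ → Fin z → ℝ := fun n => Nat.rec x₀ (fun t x => Fbar t *ᵥ x) n
    have hZ : ∀ t, Z (t + 1) = Fbar t *ᵥ Z t := fun t => rfl
    refine ⟨Z, fun t => Pbar t *ᵥ Z t, rfl, ?_, ?_, ?_, fun t _ => hZ t, fun t _ => rfl⟩
    · intro t ht
      have h : E t *ᵥ Z (t + 1) = A *ᵥ Z t := by
        rw [hZ, hF t ht, Matrix.mulVec_mulVec, ← Matrix.mul_assoc, hmul t ht, Matrix.one_mul]
      rw [hE t ht, Matrix.add_mulVec, Matrix.one_mulVec, ← Matrix.mulVec_mulVec] at h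
      exact eq_sub_of_add_eq h
    · intro t ht
      show Pbar t *ᵥ Z t = Aᵀ *ᵥ (Pbar (t + 1) *ᵥ Z (t + 1)) + Q t *ᵥ Z t
      rw [hZ, adj t ht]
    · show Pbar T *ᵥ Z T = Q T *ᵥ Z T
      rw [hPT]
  · intro Z ζ Z' ζ' h0 h1 h2 h3 h0' h1' h2' h3'
    have k := key Z ζ h1 h2 h3
    have k' := key Z' ζ' h1' h2' h3'
    have hZ : ∀ t ≤ T, Z t = Z' t := by
      intro t
      induction t with
      | zero => intro _; rw [h0, h0']
      | succ t ih =>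
        intro ht
        rw [step t (by omega) _ _ _ (h1 t (by omega)) (k (t + 1) ht),
          step t (by omega) _ _ _ (h1' t (by omega)) (k' (t + 1) ht), ih (by omega)]
    intro t ht
    exact ⟨hZ t ht, by rw [k t ht, k' t ht, hZ t ht]⟩

end
end

section
/- Closed form of the adversary's equilibrium policy: suppose the sequences (Z̄_t)_{t=0,…,T} and (ζ̄_t)_{t=0,…,T} in R^z satisfy Z̄_{t+1} = A Z̄_t − D_t ζ̄_{t+1}, ζ̄_t = Aᵀ ζ̄_{t+1} + Q_t Z̄_t (t = 0,…,T−1) and ζ̄_T = Q_T Z̄_T. Let (ζ̄⁰_t)_{t=0,…,T} be the sequence defined backward by ζ̄⁰_T = − Q_T Z̄_T and ζ̄⁰_t = Aᵀ ζ̄⁰_{t+1} − Q_t Z̄_t for t = 0,…,T−1, and define the adversary control V_t := − S_t⁻¹ Cᵀ ζ̄⁰_{t+1} for t = 0,…,T−1. Then ζ̄⁰_t = − ζ̄_t for every t, and the adversary control is linear feedback in the global mean field: V_t = S_t⁻¹ Cᵀ P̄_{t+1} F̄_t Z̄_t for every t = 0,…,T−1. -/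
open Matrix

noncomputable section

/-- closed form of the adversary's equilibrium policy:
`ζ̄⁰_t = -ζ̄_t` and `V_t = S_t⁻¹ Cᵀ P̄_{t+1} F̄_t Z̄_t`. -/
theorem adversary_policy_closed_form
    {z u v : ℕ} (hz : 1 ≤ z) (hu : 1 ≤ u) (hv : 1 ≤ v) (T : ℕ) (hT : 1 ≤ T)
    (A : Matrix (Fin z) (Fin z) ℝ) (B : Matrix (Fin z) (Fin u) ℝ) (C : Matrix (Fin z) (Fin v) ℝ)
    (Q : ℕ → Matrix (Fin z) (Fin z) ℝ) (hQ : ∀ t ≤ T, (Q t).PosSemidef)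
    (R : ℕ → Matrix (Fin u) (Fin u) ℝ) (hR : ∀ t < T, (R t).PosDef)
    (S : ℕ → Matrix (Fin v) (Fin v) ℝ) (hS : ∀ t < T, (S t).PosDef)
    (D : ℕ → Matrix (Fin z) (Fin z) ℝ)
    (hD : ∀ t < T, D t = B * (R t)⁻¹ * Bᵀ - C * (S t)⁻¹ * Cᵀ)
    (Pbar E Fbar : ℕ → Matrix (Fin z) (Fin z) ℝ)
    (hPT : Pbar T = Q T)
    (hE : ∀ t < T, E t = 1 + D t * Pbar (t + 1))
    (hEinv : ∀ t < T, IsUnit (E t))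
    (hPrec : ∀ t < T, Pbar t = Aᵀ * Pbar (t + 1) * (E t)⁻¹ * A + Q t)
    (hF : ∀ t < T, Fbar t = (E t)⁻¹ * A)
    (Zbar ζbar : ℕ → Fin z → ℝ)
    (hfwd : ∀ t < T, Zbar (t + 1) = A *ᵥ Zbar t - D t *ᵥ ζbar (t + 1))
    (hbwd : ∀ t < T, ζbar t = Aᵀ *ᵥ ζbar (t + 1) + Q t *ᵥ Zbar t)
    (hterm : ζbar T = Q T *ᵥ Zbar T)
    (ζ0 : ℕ → Fin z → ℝ)
    (hζ0T : ζ0 T = -(Q T *ᵥ Zbar T))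
    (hζ0rec : ∀ t < T, ζ0 t = Aᵀ *ᵥ ζ0 (t + 1) - Q t *ᵥ Zbar t)
    (V : ℕ → Fin v → ℝ)
    (hV : ∀ t < T, V t = -((S t)⁻¹ *ᵥ (Cᵀ *ᵥ ζ0 (t + 1)))) :
    (∀ t ≤ T, ζ0 t = -ζbar t) ∧
    (∀ t < T, V t = (S t)⁻¹ *ᵥ (Cᵀ *ᵥ (Pbar (t + 1) *ᵥ (Fbar t *ᵥ Zbar t)))) := by
  have hstep : ∀ t < T, ζbar (t + 1) = Pbar (t + 1) *ᵥ Zbar (t + 1) →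
      Zbar (t + 1) = Fbar t *ᵥ Zbar t := by
    intro t ht h
    have h1 : E t *ᵥ Zbar (t + 1) = A *ᵥ Zbar t := by
      have h2 := hfwd t ht
      rw [h, mulVec_mulVec] at h2
      rw [hE t ht, add_mulVec, one_mulVec]
      exact eq_sub_iff_add_eq.mp h2
    have hdet : IsUnit (E t).det := (Matrix.isUnit_iff_isUnit_det _).mp (hEinv t ht)
    rw [hF t ht, ← mulVec_mulVec, ← h1, mulVec_mulVec, Matrix.nonsing_inv_mul _ hdet, one_mulVec]
  have hP : ∀ t ≤ T, ζbar t = Pbar t *ᵥ Zbar t := by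
    intro t ht
    induction ht using Nat.decreasingInduction with
    | self => rw [hterm, hPT]
    | of_succ t ht ih =>
      rw [hbwd t ht, ih, hstep t ht ih, hPrec t ht, hF t ht, add_mulVec]
      simp only [mulVec_mulVec, Matrix.mul_assoc]
  have h0 : ∀ t ≤ T, ζ0 t = -ζbar t := by
    intro t ht
    induction ht using Nat.decreasingInduction with
    | self => rw [hterm, hζ0T]
    | of_succ t ht ih =>
      rw [hζ0rec t ht, hbwd t ht, ih, mulVec_neg]
      abel
  refine ⟨h0, fun t ht => ?_⟩
  have h := hP (t + 1) ht
  rw [hV t ht, h0 (t + 1) ht, ← hstep t ht h, ← h]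
  simp only [mulVec_neg, neg_neg]

end
end

section
/- Linear dynamics of the equilibrium local mean field driven by the global mean field: let (Z̄_t)_{t=0,…,T} in R^z satisfy Z̄_{t+1} = F̄_t Z̄_t, let (s̃_t) be defined backward by s̃_T = − Q̄_T Z̄_T, s̃_t = H̃_t s̃_{t+1} − Q̄_t Z̄_t, and let (G_t) be defined backward by G_T := − Q̄_T, G_t := H̃_t G_{t+1} F̄_t − Q̄_t. Suppose sequences (Y_t)_{t=0,…,T} and (W̃_t)_{t=0,…,T−1} in R^z satisfy, for every t = 0,…,T−1, the implicit forward equation Y_{t+1} = A Y_t − D_t ( P̃_{t+1} Y_{t+1} + s̃_{t+1} ) + W̃_t. Then for every t = 0,…,T−1, Y_{t+1} = Ẽ_t⁻¹ A Y_t + F̃²_t Z̄_t + Ẽ_t⁻¹ W̃_t, where F̃²_t := − Ẽ_t⁻¹ D_t G_{t+1} F̄_t. -/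
open Matrix

noncomputable section

/-- linear dynamics of the equilibrium local mean field driven by the
global mean field: `Y_{t+1} = Ẽ_t⁻¹ A Y_t + F̃²_t Z̄_t + Ẽ_t⁻¹ W̃_t` with
`F̃²_t = -Ẽ_t⁻¹ D_t G_{t+1} F̄_t`. -/
theorem local_mf_linear_dynamics
    {z u v : ℕ} (hz : 1 ≤ z) (hu : 1 ≤ u) (hv : 1 ≤ v) (T : ℕ) (hT : 1 ≤ T)
    (A : Matrix (Fin z) (Fin z) ℝ) (B : Matrix (Fin z) (Fin u) ℝ) (C : Matrix (Fin z) (Fin v) ℝ)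
    (Q Qbar : ℕ → Matrix (Fin z) (Fin z) ℝ)
    (hQ : ∀ t ≤ T, (Q t).PosSemidef) (hQbar : ∀ t ≤ T, (Qbar t).PosSemidef)
    (R : ℕ → Matrix (Fin u) (Fin u) ℝ) (hR : ∀ t < T, (R t).PosDef)
    (S : ℕ → Matrix (Fin v) (Fin v) ℝ) (hS : ∀ t < T, (S t).PosDef)
    (D : ℕ → Matrix (Fin z) (Fin z) ℝ)
    (hD : ∀ t < T, D t = B * (R t)⁻¹ * Bᵀ - C * (S t)⁻¹ * Cᵀ)
    (Pbar E Fbar : ℕ → Matrix (Fin z) (Fin z) ℝ)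
    (hPT : Pbar T = Q T)
    (hE : ∀ t < T, E t = 1 + D t * Pbar (t + 1))
    (hEinv : ∀ t < T, IsUnit (E t))
    (hPrec : ∀ t < T, Pbar t = Aᵀ * Pbar (t + 1) * (E t)⁻¹ * A + Q t)
    (hF : ∀ t < T, Fbar t = (E t)⁻¹ * A)
    (Ptil Etil Htil : ℕ → Matrix (Fin z) (Fin z) ℝ)
    (hPtT : Ptil T = Q T + Qbar T)
    (hEt : ∀ t < T, Etil t = 1 + D t * Ptil (t + 1))
    (hEtinv : ∀ t < T, IsUnit (Etil t))
    (hPtrec : ∀ t < T, Ptil t = Aᵀ * Ptil (t + 1) * (Etil t)⁻¹ * A + Q t + Qbar t)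
    (hHt : ∀ t < T, Htil t = Aᵀ * (1 - Ptil (t + 1) * (Etil t)⁻¹ * D t))
    (Zbar : ℕ → Fin z → ℝ)
    (hZdyn : ∀ t < T, Zbar (t + 1) = Fbar t *ᵥ Zbar t)
    (stil : ℕ → Fin z → ℝ)
    (hsT : stil T = -(Qbar T *ᵥ Zbar T))
    (hsrec : ∀ t < T, stil t = Htil t *ᵥ stil (t + 1) - Qbar t *ᵥ Zbar t)
    (Gm : ℕ → Matrix (Fin z) (Fin z) ℝ)
    (hGT : Gm T = -Qbar T)
    (hGrec : ∀ t < T, Gm t = Htil t * Gm (t + 1) * Fbar t - Qbar t)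
    (Y Wtil : ℕ → Fin z → ℝ)
    (hYimp : ∀ t < T,
      Y (t + 1) = A *ᵥ Y t - D t *ᵥ (Ptil (t + 1) *ᵥ Y (t + 1) + stil (t + 1)) + Wtil t) :
    ∀ t < T, Y (t + 1) = ((Etil t)⁻¹ * A) *ᵥ Y t
      + (-((Etil t)⁻¹ * D t * Gm (t + 1) * Fbar t)) *ᵥ Zbar t
      + (Etil t)⁻¹ *ᵥ Wtil t := by
  have key : ∀ t ≤ T, stil t = Gm t *ᵥ Zbar t := by
    intro t ht
    induction ht using Nat.decreasingInduction with
    | self => rw [hsT, hGT, neg_mulVec]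
    | of_succ t ht ih =>
      rw [hsrec t ht, hGrec t ht, ih, hZdyn t ht, sub_mulVec]
      simp only [mulVec_mulVec, Matrix.mul_assoc]
  intro t ht
  have h1 : Etil t *ᵥ Y (t + 1) = A *ᵥ Y t - D t *ᵥ stil (t + 1) + Wtil t := by
    have h := hYimp t ht
    rw [mulVec_add, mulVec_mulVec] at h
    rw [hEt t ht, add_mulVec, one_mulVec]
    nth_rewrite 1 [h]
    abel
  have h2 : (Etil t)⁻¹ *ᵥ (Etil t *ᵥ Y (t + 1)) = Y (t + 1) := by
    rw [mulVec_mulVec, Matrix.nonsing_inv_mul _ ((Matrix.isUnit_iff_isUnit_det _).1 (hEtinv t ht)),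
      one_mulVec]
  rw [← h2, h1, key (t + 1) ht, hZdyn t ht, mulVec_add, mulVec_sub, neg_mulVec]
  simp only [mulVec_mulVec, Matrix.mul_assoc]
  abel

end
end
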